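/- arXiv:1302.0233 — 2 statements merged into one kernel-verified Lean document; each statement's English description precedes it below -/
import Mathlib

section
/- Let G ⊆ ℝⁿ be open and connected, and let F ⊊ G be relatively closed in G (i.e. closed in the subspace topology of G and F ≠ G). Then C_{p(·)}(F) = 0 if and only if C_{p(·)}(∂F ∩ G) = 0, where ∂F denotes the topological boundary (frontier) of F in ℝⁿ. -/
open MeasureTheory Filter Topology
open scoped ENNReal NNReal

/-- The Sobolev `p(·)`-capacity of a set `E ⊆ ℝⁿ`: the infimum of
`∫ (|u|^{p(x)} + |∇u|^{p(x)})` over all smooth `u` with `u ≥ 1` in a neighbourhood of `E`. -/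
noncomputable def pCapacity {n : ℕ} (p : EuclideanSpace ℝ (Fin n) → ℝ)
    (E : Set (EuclideanSpace ℝ (Fin n))) : ℝ≥0∞ :=
  ⨅ (u : EuclideanSpace ℝ (Fin n) → ℝ)
    (_ : ContDiff ℝ (⊤ : ℕ∞) u ∧ ∃ U : Set (EuclideanSpace ℝ (Fin n)),
          IsOpen U ∧ E ⊆ U ∧ ∀ x ∈ U, 1 ≤ u x),
    ∫⁻ x, ENNReal.ofReal (|u x| ^ p x + ‖fderiv ℝ u x‖ ^ p x)

/-- `p` is log-Hölder continuous. -/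
def LogHolder {n : ℕ} (p : EuclideanSpace ℝ (Fin n) → ℝ) : Prop :=
  ∃ L : ℝ, 0 < L ∧ ∀ x y : EuclideanSpace ℝ (Fin n),
    |p x - p y| ≤ L / Real.log (Real.exp 1 + 1 / ‖x - y‖)

/-- A preconnected set meeting both a set and its complement meets its frontier. -/
theorem IsPreconnected.inter_frontier_nonempty_of_inter_compl {X : Type*} [TopologicalSpace X]
    {s t : Set X} (hs : IsPreconnected s) (h : (s ∩ t).Nonempty) (h' : (s ∩ tᶜ).Nonempty) :
    (s ∩ frontier t).Nonempty := by
  by_contra hne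
  have hfr : ∀ x ∈ s, x ∉ frontier t := fun x hx hxt => hne ⟨x, hx, hxt⟩
  have hin : ∀ x ∈ s, x ∈ t → x ∈ interior t := fun x hx hxt => by
    by_contra hxi
    exact hfr x hx ⟨subset_closure hxt, hxi⟩
  have hout : ∀ x ∈ s, x ∉ t → x ∈ (closure t)ᶜ := fun x hx hxt hxc =>
    hfr x hx ⟨hxc, fun hxi => hxt (interior_subset hxi)⟩
  obtain ⟨x, hx, hxt⟩ := h
  obtain ⟨y, hy, hyt⟩ := h'
  obtain ⟨z, -, hz, hz'⟩ := hs _ _ isOpen_interior isClosed_closure.isOpen_compl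
    (fun z hz => (em (z ∈ t)).imp (hin z hz) (hout z hz))
    ⟨x, hx, hin x hx hxt⟩ ⟨y, hy, hout y hy hyt⟩
  exact hz' (subset_closure (interior_subset hz))

theorem pCapacity_mono {n : ℕ} (p : EuclideanSpace ℝ (Fin n) → ℝ)
    {E E' : Set (EuclideanSpace ℝ (Fin n))} (h : E ⊆ E') : pCapacity p E ≤ pCapacity p E' := by
  unfold pCapacity
  refine le_iInf₂ fun u hu => ?_
  obtain ⟨hu, U, hU, hE, h1⟩ := hu
  exact iInf₂_le u ⟨hu, U, hU, h.trans hE, h1⟩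

theorem le_add_mul_rpow {s ε q Q : ℝ} (hs : 0 ≤ s) (hε : 0 < ε) (hε1 : ε ≤ 1) (hq : 1 ≤ q)
    (hqQ : q ≤ Q) : s ≤ ε + ε ^ (1 - Q) * s ^ q := by
  rcases le_total s ε with h | h
  · have : 0 ≤ ε ^ (1 - Q) * s ^ q := by positivity
    linarith
  · have hs' : 0 < s := hε.trans_le h
    have h1 : s ^ (1 - q) ≤ ε ^ (1 - q) := Real.rpow_le_rpow_of_nonpos hε h (by linarith)
    have h2 : ε ^ (1 - q) ≤ ε ^ (1 - Q) :=
      Real.rpow_le_rpow_of_exponent_ge hε hε1 (by linarith)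
    have h3 : s = s ^ (1 - q) * s ^ q := by
      rw [← Real.rpow_add hs']; simp
    have h4 : s ^ (1 - q) * s ^ q ≤ ε ^ (1 - Q) * s ^ q :=
      mul_le_mul_of_nonneg_right (h1.trans h2) (by positivity)
    linarith

/-- A smooth function reaching the value `1` somewhere on a segment is controlled from below
by its value at one endpoint and the integral of its gradient along the segment. -/
theorem one_le_ofReal_add_lintegral_segment {E : Type*} [NormedAddCommGroup E] [NormedSpace ℝ E]
    {u : E → ℝ} (hu : ContDiff ℝ (⊤ : ℕ∞) u) (c v : E) {t₀ : ℝ} (ht₀ : t₀ ∈ Set.Icc (0 : ℝ) 1)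
    (h1 : 1 ≤ u (t₀ • v + c)) :
    1 ≤ ENNReal.ofReal |u c| +
      ∫⁻ t in Set.Ioc (0 : ℝ) 1, ENNReal.ofReal (‖v‖ * ‖fderiv ℝ u (t • v + c)‖) := by
  have hdc : Continuous (fderiv ℝ u) := hu.continuous_fderiv (by simp)
  have hd : ∀ t : ℝ, HasDerivAt (fun t : ℝ => u (t • v + c)) (fderiv ℝ u (t • v + c) v) t := by
    intro t
    have hz : HasDerivAt (fun t : ℝ => t • v + c) v t := by
      simpa using ((hasDerivAt_id t).smul_const v).add_const c
    exact ((hu.differentiable (by simp)) _).hasFDerivAt.comp_hasDerivAt t hz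
  have hcont : Continuous fun t : ℝ => fderiv ℝ u (t • v + c) v := by fun_prop
  have hcont' : Continuous fun t : ℝ => ‖v‖ * ‖fderiv ℝ u (t • v + c)‖ := by fun_prop
  have hftc := intervalIntegral.integral_eq_sub_of_hasDerivAt (a := 0) (b := t₀)
    (fun t _ => hd t) (hcont.intervalIntegrable _ _)
  have hle : ∫ t in (0 : ℝ)..t₀, fderiv ℝ u (t • v + c) v
      ≤ ∫ t in (0 : ℝ)..1, ‖v‖ * ‖fderiv ℝ u (t • v + c)‖ := by
    refine (intervalIntegral.integral_mono_on ht₀.1 (hcont.intervalIntegrable _ _)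
      (hcont'.intervalIntegrable _ _) fun t _ => ?_).trans
      (intervalIntegral.integral_mono_interval le_rfl ht₀.1 ht₀.2
        (Eventually.of_forall fun t => by simp only [Pi.zero_apply]; positivity) (hcont'.intervalIntegrable _ _))
    exact (le_abs_self _).trans (((fderiv ℝ u (t • v + c)).le_opNorm v).trans_eq (mul_comm _ _))
  rw [intervalIntegral.integral_of_le zero_le_one] at hle
  rw [← ofReal_integral_eq_lintegral_ofReal
    ((intervalIntegrable_iff_integrableOn_Ioc_of_le zero_le_one).1
      (hcont'.intervalIntegrable _ _)) (Eventually.of_forall fun t => by simp only [Pi.zero_apply]; positivity),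
    ← ENNReal.ofReal_add (abs_nonneg _) (integral_nonneg fun t => by simp only [Pi.zero_apply]; positivity),
    ← ENNReal.ofReal_one]
  refine ENNReal.ofReal_le_ofReal ?_
  simp only [zero_smul, zero_add] at hftc
  linarith [le_abs_self (u c)]

/-- If all segments joining corresponding points of two balls of equal radius meet `S`, then
`S` has positive capacity. -/
theorem pCapacity_ne_zero_of_segments_meet {n : ℕ} {p : EuclideanSpace ℝ (Fin n) → ℝ} {pp : ℝ}
    (hp1 : ∀ x, 1 ≤ p x) (hpp : ∀ x, p x ≤ pp) {S : Set (EuclideanSpace ℝ (Fin n))}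
    {a v : EuclideanSpace ℝ (Fin n)} {r : ℝ} (hr : 0 < r)
    (hS : ∀ c ∈ Metric.ball a r, ∃ t ∈ Set.Icc (0 : ℝ) 1, t • v + c ∈ S) :
    pCapacity p S ≠ 0 := by
  intro h0
  set m := volume (Metric.ball a r)
  have hm0 : m ≠ 0 := (Metric.measure_ball_pos volume a hr).ne'
  have hmt : m ≠ ⊤ := measure_ball_lt_top.ne
  set ε : ℝ := (2 * (1 + ‖v‖))⁻¹ with hεdef
  have hε : 0 < ε := by positivity
  have hε1 : ε ≤ 1 := inv_le_one_of_one_le₀ (by linarith [norm_nonneg v])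
  set K : ℝ≥0∞ := ENNReal.ofReal (ε ^ (1 - pp))
  set V : ℝ≥0∞ := ENNReal.ofReal ‖v‖
  have key : ∀ ρ, ρ ∈ Set.Ioi (0 : ℝ≥0∞) →
      m ≤ (1 + V) * (ENNReal.ofReal ε * m + K * ρ) := by
    intro ρ hρ
    have hlt : pCapacity p S < ρ := h0 ▸ hρ
    simp only [pCapacity, iInf_lt_iff] at hlt
    obtain ⟨u, ⟨hu, U, -, hSU, hU1⟩, hint⟩ := hlt
    set g := fun x => ENNReal.ofReal (|u x| ^ p x + ‖fderiv ℝ u x‖ ^ p x) with hg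
    have hdc : Continuous (fderiv ℝ u) := hu.continuous_fderiv (by simp)
    have hpt : ∀ s x, 0 ≤ s → s ^ p x ≤ |u x| ^ p x + ‖fderiv ℝ u x‖ ^ p x →
        ENNReal.ofReal s ≤ ENNReal.ofReal ε + K * g x := by
      intro s x hs hsx
      rw [← ENNReal.ofReal_mul (by positivity), ← ENNReal.ofReal_add hε.le (by positivity)]
      refine ENNReal.ofReal_le_ofReal ((le_add_mul_rpow hs hε hε1 (hp1 x) (hpp x)).trans ?_)
      gcongr
    have hball : ∀ (w : EuclideanSpace ℝ (Fin n)) (f : EuclideanSpace ℝ (Fin n) → ℝ≥0∞),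
        (∀ x, f x ≤ ENNReal.ofReal ε + K * g x) →
        ∫⁻ c in Metric.ball a r, f (w + c) ≤ ENNReal.ofReal ε * m + K * ρ := by
      intro w f hf
      calc ∫⁻ c in Metric.ball a r, f (w + c)
          ≤ ∫⁻ c in Metric.ball a r, (ENNReal.ofReal ε + K * g (w + c)) :=
            lintegral_mono fun c => hf _
        _ = ENNReal.ofReal ε * m + K * ∫⁻ c in Metric.ball a r, g (w + c) := by
            rw [lintegral_add_left measurable_const, setLIntegral_const,
              lintegral_const_mul' _ _ ENNReal.ofReal_ne_top]
        _ ≤ ENNReal.ofReal ε * m + K * ∫⁻ c, g (w + c) := by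
            gcongr
            exact Measure.restrict_le_self
        _ ≤ ENNReal.ofReal ε * m + K * ρ := by
            rw [lintegral_add_left_eq_self g w]
            gcongr
    have hu' : Continuous u := hu.continuous
    calc m = ∫⁻ c in Metric.ball a r, 1 := by simp [m]
      _ ≤ ∫⁻ c in Metric.ball a r, (ENNReal.ofReal |u c| +
          ∫⁻ t in Set.Ioc (0 : ℝ) 1, ENNReal.ofReal (‖v‖ * ‖fderiv ℝ u (t • v + c)‖)) := by
          refine setLIntegral_mono' measurableSet_ball fun c hc => ?_
          obtain ⟨t, ht, hts⟩ := hS c hc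
          exact one_le_ofReal_add_lintegral_segment hu c v ht (hU1 _ (hSU hts))
      _ = (∫⁻ c in Metric.ball a r, ENNReal.ofReal |u (0 + c)|) +
          ∫⁻ t in Set.Ioc (0 : ℝ) 1, V * ∫⁻ c in Metric.ball a r,
            ENNReal.ofReal ‖fderiv ℝ u (t • v + c)‖ := by
          rw [lintegral_add_left (by fun_prop), lintegral_lintegral_swap]
          · simp only [zero_add, ENNReal.ofReal_mul (norm_nonneg v)]
            congr 1
            refine lintegral_congr fun t => ?_
            rw [lintegral_const_mul' _ _ ENNReal.ofReal_ne_top]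
          · refine Measurable.aemeasurable (Continuous.measurable ?_)
            unfold Function.uncurry
            exact ENNReal.continuous_ofReal.comp (by fun_prop)
      _ ≤ (ENNReal.ofReal ε * m + K * ρ) +
          ∫⁻ t in Set.Ioc (0 : ℝ) 1, V * (ENNReal.ofReal ε * m + K * ρ) := by
          refine add_le_add (hball 0 (fun x => ENNReal.ofReal |u x|) fun x => ?_)
            (lintegral_mono fun t => mul_le_mul_right
              (hball (t • v) (fun x => ENNReal.ofReal ‖fderiv ℝ u x‖) fun x => ?_) _)
          · exact hpt _ x (abs_nonneg _) (le_add_of_nonneg_right (by positivity))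
          · exact hpt _ x (norm_nonneg _) (le_add_of_nonneg_left (by positivity))
      _ = (1 + V) * (ENNReal.ofReal ε * m + K * ρ) := by
          simp [add_mul]
  have hlim : Tendsto (fun ρ : ℝ≥0∞ => (1 + V) * (ENNReal.ofReal ε * m + K * ρ)) (𝓝[>] 0)
      (𝓝 ((1 + V) * (ENNReal.ofReal ε * m + K * 0))) := by
    refine tendsto_nhdsWithin_of_tendsto_nhds ?_
    refine ENNReal.Tendsto.const_mul (tendsto_const_nhds.add
      (ENNReal.Tendsto.const_mul tendsto_id (Or.inr ENNReal.ofReal_ne_top))) (Or.inr ?_)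
    exact ENNReal.add_ne_top.2 ⟨ENNReal.one_ne_top, ENNReal.ofReal_ne_top⟩
  have hle := ge_of_tendsto hlim (eventually_mem_nhdsWithin.mono key)
  have hV : (1 + V) * ENNReal.ofReal ε = ENNReal.ofReal (1 / 2) := by
    rw [← ENNReal.ofReal_one, ← ENNReal.ofReal_add zero_le_one (norm_nonneg v),
      ← ENNReal.ofReal_mul (by positivity)]
    congr 1
    rw [hεdef]
    field_simp
  rw [mul_zero, add_zero, ← mul_assoc, hV] at hle
  have hm := ENNReal.toReal_pos hm0 hmt
  have := ENNReal.toReal_mono (ENNReal.mul_ne_top ENNReal.ofReal_ne_top hmt) hle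
  rw [ENNReal.toReal_mul, ENNReal.toReal_ofReal (by norm_num)] at this
  linarith

/-- A relatively closed proper subset of a connected open set whose relative boundary has zero
capacity has empty interior. -/
theorem interior_eq_empty_of_pCapacity_frontier_eq_zero {n : ℕ}
    {p : EuclideanSpace ℝ (Fin n) → ℝ} {pp : ℝ}
    (hp1 : ∀ x, 1 ≤ p x) (hpp : ∀ x, p x ≤ pp) {G C : Set (EuclideanSpace ℝ (Fin n))}
    (hG : IsOpen G) (hGconn : IsPreconnected G) (hC : IsClosed C) (hne : G ∩ C ≠ G)
    (h0 : pCapacity p (frontier (G ∩ C) ∩ G) = 0) : interior (G ∩ C) = ∅ := by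
  by_contra hint
  obtain ⟨z, hz⟩ := Set.nonempty_iff_ne_empty.2 hint
  obtain ⟨w, hwG, hwF⟩ : ∃ w ∈ G, w ∉ G ∩ C := by
    by_contra! h
    exact hne (Set.inter_subset_left.antisymm h)
  obtain ⟨x, hxG, hx⟩ := hGconn.inter_frontier_nonempty_of_inter_compl
    ⟨z, (interior_subset hz).1, hz⟩ ⟨w, hwG, fun h => hwF (interior_subset h)⟩
  obtain ⟨R, hR, hRG⟩ := Metric.isOpen_iff.1 hG x hxG
  obtain ⟨a, haR, haF⟩ := mem_closure_iff.1 hx.1 _ Metric.isOpen_ball (Metric.mem_ball_self hR)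
  have hxF : x ∉ interior (G ∩ C) := by simpa using hx.2
  obtain ⟨d, hdR, hdF⟩ : ∃ d ∈ Metric.ball x R, d ∉ C := by
    by_contra! h
    exact hxF (mem_interior.2 ⟨_, fun y hy => ⟨hRG hy, h y hy⟩, Metric.isOpen_ball,
      Metric.mem_ball_self hR⟩)
  obtain ⟨r₁, hr₁, hb₁⟩ := Metric.isOpen_iff.1 (Metric.isOpen_ball.inter isOpen_interior) a
    ⟨haR, haF⟩
  obtain ⟨r₂, hr₂, hb₂⟩ := Metric.isOpen_iff.1 (Metric.isOpen_ball.inter hC.isOpen_compl) d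
    ⟨hdR, hdF⟩
  refine pCapacity_ne_zero_of_segments_meet (a := a) (v := d - a) hp1 hpp (lt_min hr₁ hr₂)
    (fun c hc => ?_) h0
  have hc1 := hb₁ (Metric.ball_subset_ball (min_le_left _ _) hc)
  have hc2 : d - a + c ∈ Metric.ball d r₂ := by
    have := Metric.ball_subset_ball (min_le_right _ _) hc
    rw [mem_ball_iff_norm] at this ⊢
    convert this using 2
    abel
  replace hc2 := hb₂ hc2
  have hmem : ∀ t ∈ Set.Icc (0 : ℝ) 1, t • (d - a) + c ∈ Metric.ball x R := by
    intro t ht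
    have := (convex_ball x R) hc1.1 hc2.1 (sub_nonneg.2 ht.2) ht.1 (by ring)
    convert this using 1
    module
  have hpre : IsPreconnected ((fun t : ℝ => t • (d - a) + c) '' Set.Icc 0 1) :=
    isPreconnected_Icc.image _ (by fun_prop)
  obtain ⟨-, ⟨t, ht, rfl⟩, hfr⟩ := hpre.inter_frontier_nonempty_of_inter_compl (t := G ∩ C)
    ⟨c, ⟨0, by simp, by simp⟩, interior_subset hc1.2⟩
    ⟨d - a + c, ⟨1, by simp, by simp⟩, fun h => hc2.2 h.2⟩
  exact ⟨t, ht, hfr, hRG (hmem t ht)⟩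

/-- If `G` is open and connected and `F ⊊ G` is relatively closed in `G`,
then `C_{p(·)}(F) = 0` if and only if `C_{p(·)}(∂F ∩ G) = 0`. -/
theorem capacity_zero_iff_capacity_frontier_zero
    {n : ℕ}
    (p : EuclideanSpace ℝ (Fin n) → ℝ) (hpmeas : Measurable p)
    (pm pp : ℝ) (hpm : 1 < pm) (hbd : ∀ x, pm ≤ p x ∧ p x ≤ pp)
    (hlog : LogHolder p)
    (G F : Set (EuclideanSpace ℝ (Fin n)))
    (hGopen : IsOpen G) (hGconn : IsConnected G)
    (hFG : F ⊆ G) (hFne : F ≠ G)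
    (hFclosed : IsClosed (Subtype.val ⁻¹' F : Set G)) :
    pCapacity p F = 0 ↔ pCapacity p (frontier F ∩ G) = 0 := by
  obtain ⟨C, hC, hCF⟩ := isClosed_induced_iff.1 hFclosed
  obtain rfl : F = G ∩ C := by
    rw [Subtype.preimage_val_eq_preimage_val_iff] at hCF
    rw [hCF, Set.inter_eq_right.2 hFG]
  constructor
  · have hsub : frontier (G ∩ C) ∩ G ⊆ G ∩ C := fun x hx =>
      ⟨hx.2, closure_minimal Set.inter_subset_right hC hx.1.1⟩
    exact fun h => le_antisymm ((pCapacity_mono p hsub).trans h.le) zero_le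
  · intro h
    have hint := interior_eq_empty_of_pCapacity_frontier_eq_zero
      (fun x => hpm.le.trans (hbd x).1) (fun x => (hbd x).2) hGopen hGconn.isPreconnected hC hFne h
    have hsub : G ∩ C ⊆ frontier (G ∩ C) ∩ G := fun x hx =>
      ⟨⟨subset_closure hx, by simp [hint]⟩, hx.1⟩
    exact le_antisymm ((pCapacity_mono p hsub).trans h.le) zero_le
end

section
/- Let Ω ⊆ ℝⁿ be a nonempty open set and let V ⊆ ∂Ω be relatively open in ∂Ω (the topological boundary of Ω in ℝⁿ). If C_{p(·)}(V) = 0, then the set Ω ∪ V is open in ℝⁿ. -/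
open MeasureTheory Filter Topology
open scoped ENNReal NNReal

/-- A quantitative Young-type bound of `s` by a small constant plus a multiple of `s ^ q`. -/
theorem le_add_rpow_mul_rpow {s δ q Q : ℝ} (hs : 0 ≤ s) (hδ : 0 < δ) (hδ1 : δ ≤ 1)
    (hq : 1 ≤ q) (hqQ : q ≤ Q) : s ≤ δ + δ ^ (1 - Q) * s ^ q := by
  rcases le_or_gt s δ with h | h
  · have : 0 ≤ δ ^ (1 - Q) * s ^ q := by positivity
    linarith
  · have hs0 : 0 < s := hδ.trans h
    have h1 : s ^ (1 - q) ≤ δ ^ (1 - q) :=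
      Real.rpow_le_rpow_of_nonpos hδ h.le (by linarith)
    have h2 : δ ^ (1 - q) ≤ δ ^ (1 - Q) :=
      Real.rpow_le_rpow_of_exponent_ge hδ hδ1 (by linarith)
    have h3 : s = s ^ (1 - q) * s ^ q := by
      rw [← Real.rpow_add hs0]
      simp
    have h4 : s ^ (1 - q) * s ^ q ≤ δ ^ (1 - Q) * s ^ q := by
      gcongr
      exact h1.trans h2
    linarith

/-- A `C¹` function which is at least `1` somewhere on a segment is controlled from below by its
value at the starting point and its gradient along the segment. -/
theorem one_le_enorm_add_lintegral_fderiv {E : Type*} [NormedAddCommGroup E] [NormedSpace ℝ E]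
    {u : E → ℝ} (hu : ContDiff ℝ 1 u) (x d : E) {t : ℝ} (ht : t ∈ Set.Icc (0 : ℝ) 1)
    (h1 : 1 ≤ u (x + t • d)) :
    1 ≤ ‖u x‖ₑ + ‖d‖ₑ * ∫⁻ r in Set.Icc (0 : ℝ) 1, ‖fderiv ℝ u (x + r • d)‖ₑ := by
  have hcont : Continuous fun r : ℝ => fderiv ℝ u (x + r • d) d :=
    ((hu.continuous_fderiv (by simp)).comp (by fun_prop)).clm_apply continuous_const
  have hderiv : ∀ r : ℝ, HasDerivAt (fun r : ℝ => u (x + r • d)) (fderiv ℝ u (x + r • d) d) r := by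
    intro r
    have hl : HasDerivAt (fun r : ℝ => x + r • d) d r := by
      simpa using ((hasDerivAt_id r).smul_const d).const_add x
    exact ((hu.differentiable (by simp)) _).hasFDerivAt.comp_hasDerivAt r hl
  have hftc : ∫ r in (0 : ℝ)..t, fderiv ℝ u (x + r • d) d = u (x + t • d) - u x := by
    rw [intervalIntegral.integral_eq_sub_of_hasDerivAt (fun r _ => hderiv r)
      (hcont.intervalIntegrable _ _)]
    simp
  calc (1 : ℝ≥0∞) ≤ ‖u (x + t • d)‖ₑ := by
        rw [Real.enorm_eq_ofReal_abs, ← ENNReal.ofReal_one]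
        exact ENNReal.ofReal_le_ofReal (h1.trans (le_abs_self _))
    _ = ‖u x + ∫ r in (0 : ℝ)..t, fderiv ℝ u (x + r • d) d‖ₑ := by rw [hftc]; simp
    _ ≤ ‖u x‖ₑ + ‖∫ r in (0 : ℝ)..t, fderiv ℝ u (x + r • d) d‖ₑ := enorm_add_le _ _
    _ ≤ ‖u x‖ₑ + ∫⁻ r in Set.Ioc (0 : ℝ) t, ‖fderiv ℝ u (x + r • d) d‖ₑ := by
        rw [intervalIntegral.integral_of_le ht.1]
        gcongr
        exact enorm_integral_le_lintegral_enorm _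
    _ ≤ ‖u x‖ₑ + ∫⁻ r in Set.Icc (0 : ℝ) 1, ‖d‖ₑ * ‖fderiv ℝ u (x + r • d)‖ₑ := by
        gcongr ‖u x‖ₑ + ?_
        refine (lintegral_mono_set ?_).trans (lintegral_mono fun r => ?_)
        · exact Set.Ioc_subset_Icc_self.trans (Set.Icc_subset_Icc_right ht.2)
        · rw [mul_comm]
          exact ContinuousLinearMap.le_opENorm _ _
    _ = _ := by rw [lintegral_const_mul' _ _ enorm_ne_top]

/-- If `u ≥ 1` somewhere on every segment from `x` to `x + d` with `x ∈ A`, then the measure of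
`A` is controlled by the `L¹` norms of `u` and `∇u`, hence by any function dominating them. -/
theorem measure_le_of_segments {n : ℕ} {u : EuclideanSpace ℝ (Fin n) → ℝ} (hu : ContDiff ℝ 1 u)
    {A : Set (EuclideanSpace ℝ (Fin n))} (hA : MeasurableSet A)
    (d : EuclideanSpace ℝ (Fin n))
    (hseg : ∀ x ∈ A, ∃ t ∈ Set.Icc (0 : ℝ) 1, 1 ≤ u (x + t • d))
    {G : EuclideanSpace ℝ (Fin n) → ℝ≥0∞} {D K : ℝ≥0∞} (hK : K ≠ ∞)
    (hG : ∀ x, ‖u x‖ₑ ≤ D + K * G x) (hG' : ∀ x, ‖fderiv ℝ u x‖ₑ ≤ D + K * G x) :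
    volume A ≤ (1 + ‖d‖ₑ) * (D * volume A + K * ∫⁻ x, G x) := by
  have hcu : Continuous u := hu.continuous
  have hcd : Continuous (fderiv ℝ u) := hu.continuous_fderiv (by simp)
  have hbound : ∀ z, ∫⁻ x in A, (D + K * G (x + z)) ≤ D * volume A + K * ∫⁻ x, G x := by
    intro z
    rw [lintegral_add_left measurable_const, lintegral_const_mul' _ _ hK, setLIntegral_const]
    gcongr D * volume A + K * ?_
    exact (setLIntegral_le_lintegral _ _).trans (lintegral_add_right_eq_self (μ := volume) G z).le
  calc volume A = ∫⁻ _ in A, 1 := by simp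
    _ ≤ ∫⁻ x in A, (‖u x‖ₑ + ‖d‖ₑ * ∫⁻ r in Set.Icc (0 : ℝ) 1, ‖fderiv ℝ u (x + r • d)‖ₑ) := by
        refine setLIntegral_mono' hA fun x hx => ?_
        obtain ⟨t, ht, h1⟩ := hseg x hx
        exact one_le_enorm_add_lintegral_fderiv hu x d ht h1
    _ = (∫⁻ x in A, ‖u x‖ₑ) +
          ‖d‖ₑ * ∫⁻ r in Set.Icc (0 : ℝ) 1, ∫⁻ x in A, ‖fderiv ℝ u (x + r • d)‖ₑ := by
        rw [lintegral_add_left hcu.enorm.measurable, lintegral_const_mul' _ _ enorm_ne_top,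
          lintegral_lintegral_swap]
        refine Measurable.aemeasurable (Continuous.measurable ?_)
        exact (hcd.comp (by fun_prop : Continuous
          fun q : EuclideanSpace ℝ (Fin n) × ℝ => q.1 + q.2 • d)).enorm
    _ ≤ (D * volume A + K * ∫⁻ x, G x) +
          ‖d‖ₑ * ∫⁻ _ in Set.Icc (0 : ℝ) 1, (D * volume A + K * ∫⁻ x, G x) := by
        gcongr with r
        · refine (lintegral_mono fun x => hG x).trans ?_
          simpa using hbound 0
        · exact (lintegral_mono fun x => hG' _).trans (hbound _)
    _ = _ := by
        rw [setLIntegral_const, Real.volume_Icc]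
        simp [add_mul]

/-- A set which meets all segments from `x` to `x + d`, `x ∈ A`, where `A` has positive and finite
measure, has positive `p(·)`-capacity. -/
theorem pCapacity_ne_zero_of_segments {n : ℕ} {p : EuclideanSpace ℝ (Fin n) → ℝ} {Q : ℝ}
    (hp : ∀ x, 1 ≤ p x ∧ p x ≤ Q) {A V : Set (EuclideanSpace ℝ (Fin n))}
    (hA : MeasurableSet A) (hA0 : volume A ≠ 0) (hAtop : volume A ≠ ∞)
    (d : EuclideanSpace ℝ (Fin n))
    (hseg : ∀ x ∈ A, ∃ t ∈ Set.Icc (0 : ℝ) 1, x + t • d ∈ V) :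
    pCapacity p V ≠ 0 := by
  intro hcap
  set δ : ℝ := 1 / (2 * (1 + ‖d‖)) with hδdef
  have hd := norm_nonneg d
  have hδ : 0 < δ := by positivity
  have hδ1 : δ ≤ 1 := by
    rw [hδdef, div_le_one (by positivity)]
    linarith
  set D := ENNReal.ofReal δ
  set K := ENNReal.ofReal (δ ^ (1 - Q))
  have hDc : (1 + ‖d‖ₑ) * D = 2⁻¹ := by
    rw [← ofReal_norm, ← ENNReal.ofReal_one, ← ENNReal.ofReal_add zero_le_one hd,
      ← ENNReal.ofReal_mul (by positivity), hδdef]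
    rw [show (1 + ‖d‖) * (1 / (2 * (1 + ‖d‖))) = 2⁻¹ by field_simp,
      ENNReal.ofReal_inv_of_pos two_pos]
    simp
  have hc : (1 + ‖d‖ₑ) * K ≠ ∞ :=
    ENNReal.mul_ne_top (by simp) ENNReal.ofReal_ne_top
  have key : ∀ ε : ℝ≥0∞, 0 < ε → volume A ≤ 2⁻¹ * volume A + (1 + ‖d‖ₑ) * K * ε := by
    intro ε hε
    have hlt : pCapacity p V < ε := hcap ▸ hε
    simp only [pCapacity, iInf_lt_iff] at hlt
    obtain ⟨u, ⟨hu, U, -, hVU, hU⟩, hlt⟩ := hlt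
    have hdom : ∀ x s, 0 ≤ s → s ^ p x ≤ |u x| ^ p x + ‖fderiv ℝ u x‖ ^ p x →
        ENNReal.ofReal s ≤
          D + K * ENNReal.ofReal (|u x| ^ p x + ‖fderiv ℝ u x‖ ^ p x) := by
      intro x s hs hle
      rw [← ENNReal.ofReal_mul (by positivity), ← ENNReal.ofReal_add hδ.le (by positivity)]
      refine ENNReal.ofReal_le_ofReal
        ((le_add_rpow_mul_rpow hs hδ hδ1 (hp x).1 (hp x).2).trans ?_)
      gcongr
    have hmain := measure_le_of_segments (hu.of_le (by exact_mod_cast le_top)) hA d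
      (fun x hx => (hseg x hx).imp fun t ht => ⟨ht.1, hU _ (hVU ht.2)⟩)
      (G := fun x => ENNReal.ofReal (|u x| ^ p x + ‖fderiv ℝ u x‖ ^ p x))
      (D := D) (K := K) ENNReal.ofReal_ne_top
      (fun x => by
        rw [Real.enorm_eq_ofReal_abs]
        exact hdom x _ (abs_nonneg _) (le_add_of_nonneg_right (by positivity)))
      (fun x => by
        rw [← ofReal_norm]
        exact hdom x _ (norm_nonneg _) (le_add_of_nonneg_left (by positivity)))
    rw [mul_add, ← mul_assoc, ← mul_assoc, hDc] at hmain
    exact hmain.trans (by gcongr)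
  have hle : volume A ≤ 2⁻¹ * volume A := by
    refine ENNReal.le_of_forall_pos_le_add fun ε hε _ => ?_
    obtain ⟨η, hη, hηε⟩ : ∃ η : ℝ≥0∞, 0 < η ∧ (1 + ‖d‖ₑ) * K * η ≤ ε := by
      refine ⟨ε / ((1 + ‖d‖ₑ) * K), ENNReal.div_pos (by simpa using hε.ne') hc, ENNReal.mul_div_le⟩
    exact (key η hη).trans (by gcongr)
  have hlt : 2⁻¹ * volume A < volume A := by
    rw [mul_comm, ← div_eq_mul_inv]
    exact ENNReal.half_lt_self hA0 hAtop
  exact absurd hle hlt.not_ge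

/-- A preconnected set meeting both an open set and the complement of its closure meets its
frontier. -/
theorem IsPreconnected.inter_frontier_nonempty_of_isOpen {X : Type*} [TopologicalSpace X]
    {s t : Set X} (ht : IsPreconnected t) (hs : IsOpen s) (h1 : (t ∩ s).Nonempty)
    (h2 : (t ∩ (closure s)ᶜ).Nonempty) : (t ∩ frontier s).Nonempty := by
  by_contra hne
  have hcover : t ⊆ s ∪ (closure s)ᶜ := fun w hw => by
    by_contra hwn
    rw [Set.mem_union, not_or, Set.notMem_compl_iff] at hwn
    exact hne ⟨w, hw, hwn.2, by rw [hs.interior_eq]; exact hwn.1⟩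
  obtain ⟨w, -, hws, hwc⟩ := ht _ _ hs isClosed_closure.isOpen_compl hcover h1 h2
  exact hwc (subset_closure hws)

/-- Let `Ω` be a nonempty open set and `V ⊆ ∂Ω` be relatively open in `∂Ω`.
If `C_{p(·)}(V) = 0`, then `Ω ∪ V` is open. -/
theorem isOpen_union_of_capacity_zero
    {n : ℕ}
    (p : EuclideanSpace ℝ (Fin n) → ℝ) (hpmeas : Measurable p)
    (pm pp : ℝ) (hpm : 1 < pm) (hbd : ∀ x, pm ≤ p x ∧ p x ≤ pp)
    (hlog : LogHolder p)
    (Ω : Set (EuclideanSpace ℝ (Fin n))) (hΩopen : IsOpen Ω) (hΩne : Ω.Nonempty)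
    (V : Set (EuclideanSpace ℝ (Fin n))) (hV : V ⊆ frontier Ω)
    (hVopen : IsOpen (Subtype.val ⁻¹' V : Set (frontier Ω)))
    (hcap : pCapacity p V = 0) :
    IsOpen (Ω ∪ V) := by
  rw [Metric.isOpen_iff]
  rintro x (hx | hx)
  · obtain ⟨r, hr, hsub⟩ := Metric.isOpen_iff.1 hΩopen x hx
    exact ⟨r, hr, hsub.trans Set.subset_union_left⟩
  obtain ⟨O, hO, hOV⟩ := isOpen_induced_iff.1 hVopen
  have hmem : ∀ y ∈ frontier Ω, y ∈ O → y ∈ V := fun y hy hyO =>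
    (Set.ext_iff.1 hOV ⟨y, hy⟩).1 hyO
  obtain ⟨r, hr, hball⟩ := Metric.isOpen_iff.1 hO x ((Set.ext_iff.1 hOV ⟨x, hV hx⟩).2 hx)
  refine ⟨r, hr, fun z hz => ?_⟩
  by_contra hzn
  have hzcl : z ∉ closure Ω := fun hcl => by
    by_cases hzΩ : z ∈ Ω
    · exact hzn (Or.inl hzΩ)
    · exact hzn (Or.inr (hmem z ⟨hcl, by rwa [hΩopen.interior_eq]⟩ (hball hz)))
  obtain ⟨a, haB, haΩ⟩ := mem_closure_iff.1 (frontier_subset_closure (hV hx)) _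
    Metric.isOpen_ball (Metric.mem_ball_self hr)
  set A : Set (EuclideanSpace ℝ (Fin n)) :=
    (Metric.ball x r ∩ Ω) ∩ (fun y => y + (z - a)) ⁻¹' (Metric.ball x r ∩ (closure Ω)ᶜ)
  have hAopen : IsOpen A := (Metric.isOpen_ball.inter hΩopen).inter
    ((Metric.isOpen_ball.inter isClosed_closure.isOpen_compl).preimage (by fun_prop))
  have haA : a ∈ A := ⟨⟨haB, haΩ⟩, by simpa using ⟨hz, hzcl⟩⟩
  have hAtop : volume A ≠ ∞ :=
    ((measure_mono fun y hy => hy.1.1).trans_lt measure_ball_lt_top).ne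
  refine pCapacity_ne_zero_of_segments (fun y => ⟨hpm.le.trans (hbd y).1, (hbd y).2⟩)
    hAopen.measurableSet (hAopen.measure_pos volume ⟨a, haA⟩).ne' hAtop (z - a) ?_ hcap
  rintro y ⟨⟨hyB, hyΩ⟩, hyB', hycl⟩
  have hpre : IsPreconnected (segment ℝ y (y + (z - a))) := (convex_segment _ _).isPreconnected
  obtain ⟨w, hw, hwf⟩ := hpre.inter_frontier_nonempty_of_isOpen hΩopen
    ⟨y, left_mem_segment ℝ _ _, hyΩ⟩
    ⟨_, right_mem_segment ℝ _ _, hycl⟩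
  have hwB : w ∈ Metric.ball x r := (convex_ball x r).segment_subset hyB hyB' hw
  rw [segment_eq_image'] at hw
  obtain ⟨t, ht, rfl⟩ := hw
  refine ⟨t, ht, ?_⟩
  simpa using hmem _ hwf (hball hwB)
end
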